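/- Let P_1, P_{−1} be probability distributions on {−1,1}^d such that every x in the support of P_1 satisfies Σ_{i=1}^d x_i > 0, and such that d_TV(P_1, −P_{−1}) ≤ δ, where −P_{−1} is the pushforward of P_{−1} under x ↦ −x. Then for every a ∈ {−1,1}^{2d} and every b ∈ {0,1}, Pr_{x∼D_{a,b}}[f_{a,0}(x) = f_{a,1}(x)] ≤ δ. -/

import Mathlib

open MeasureTheory

/-- The Boolean cube `{-1,1}^d` inside `Fin d → ℝ`. -/
def cube (d : ℕ) : Set (Fin d → ℝ) := {x | ∀ i, x i = 1 ∨ x i = -1}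

/-- The Fourier coefficient `D̂(S) = E_{x∼D}[∏_{i∈S} x_i]` of a distribution on `{-1,1}^d`. -/
noncomputable def cubeFourier {d : ℕ} (D : Measure (Fin d → ℝ)) (S : Finset (Fin d)) : ℝ :=
  ∫ x, ∏ i ∈ S, x i ∂D

/-- `sign(t) = 1` if `t ≥ 0` and `-1` otherwise. -/
noncomputable def sgn (t : ℝ) : ℝ := if 0 ≤ t then 1 else -1

/-- An element of `{-1,1}^{2d}`, viewed as a pair of blocks of `d` coordinates. -/
abbrev Pair (d : ℕ) := (Fin d → ℝ) × (Fin d → ℝ)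

/-- The uniform distribution on `{-1,1} ⊆ ℝ`. -/
noncomputable def unifSign : Measure ℝ :=
  (2 : ENNReal)⁻¹ • Measure.dirac (1 : ℝ) + (2 : ENNReal)⁻¹ • Measure.dirac (-1 : ℝ)

/-- The distribution of `(y z, y z')` where `y` is uniform in `{-1,1}`, `z ∼ ν` and
`z' ∼ ν'`, all independent. -/
noncomputable def Dzero {d : ℕ} (ν ν' : Measure (Fin d → ℝ)) : Measure (Pair d) :=
  Measure.map
    (fun q : ℝ × ((Fin d → ℝ) × (Fin d → ℝ)) =>
      ((fun i => q.1 * q.2.1 i), (fun i => q.1 * q.2.2 i)))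
    (unifSign.prod (ν.prod ν'))

/-- `D_0` (for `b = false`) and `D_1` (for `b = true`), built from `P₁` and `P₋₁`. -/
noncomputable def Db {d : ℕ} (P1 Pm1 : Measure (Fin d → ℝ)) (b : Bool) : Measure (Pair d) :=
  if b then Dzero Pm1 P1 else Dzero P1 Pm1

/-- The distribution `D_{a,b}`, obtained by drawing `x' ∼ D_b` and setting `x_i = a_i x'_i`. -/
noncomputable def Dab {d : ℕ} (P1 Pm1 : Measure (Fin d → ℝ)) (a : Pair d) (b : Bool) :
    Measure (Pair d) :=
  Measure.map (fun x : Pair d => ((fun i => a.1 i * x.1 i), (fun i => a.2 i * x.2 i)))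
    (Db P1 Pm1 b)

/-- `f_{a,0}(x) = sign(∑_{i=1}^d a_i x_i)` and `f_{a,1}(x) = sign(∑_{i=d+1}^{2d} a_i x_i)`. -/
noncomputable def fab {d : ℕ} (a : Pair d) (b : Bool) (x : Pair d) : ℝ :=
  if b then sgn (∑ i, a.2 i * x.2 i) else sgn (∑ i, a.1 i * x.1 i)

/-- The total variation distance between two probability measures. -/
noncomputable def tvDist {X : Type*} [MeasurableSpace X] (P Q : Measure X) : ℝ :=
  ⨆ s : {s : Set X // MeasurableSet s}, |(P s).toReal - (Q s).toReal|

instance isProbabilityMeasure_unifSign : IsProbabilityMeasure unifSign :=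
  ⟨by simp [unifSign, ENNReal.inv_two_add_inv_two]⟩

theorem ae_unifSign : ∀ᵐ y ∂unifSign, y = 1 ∨ y = -1 := by
  have hs : MeasurableSet {y : ℝ | y = 1 ∨ y = -1} :=
    (measurableSet_singleton (1 : ℝ)).union (measurableSet_singleton (-1 : ℝ))
  refine ae_add_measure_iff.2 ⟨Measure.ae_smul_measure ?_ _, Measure.ae_smul_measure ?_ _⟩
  · exact (ae_dirac_iff hs).2 (Or.inl rfl)
  · exact (ae_dirac_iff hs).2 (Or.inr rfl)

theorem measurable_sgn : Measurable sgn :=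
  Measurable.ite measurableSet_Ici measurable_const measurable_const

theorem cube_countable (d : ℕ) : (cube d).Countable := by
  have h : (Set.pi Set.univ fun _ : Fin d => ({1, -1} : Set ℝ)).Finite :=
    Set.Finite.pi fun _ => Set.toFinite _
  exact (h.subset fun x hx i _ => by simpa using hx i).countable

/-- A property of all atoms of a probability measure on the cube holds almost everywhere. -/
theorem ae_of_forall_atom {d : ℕ} {P : Measure (Fin d → ℝ)} [IsProbabilityMeasure P]
    (hP : P (cube d) = 1) {p : (Fin d → ℝ) → Prop} (h : ∀ x, P {x} ≠ 0 → p x) :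
    ∀ᵐ x ∂P, p x := by
  have hc : ∀ᵐ x ∂P, x ∈ cube d :=
    (prob_compl_eq_zero_iff (cube_countable d).measurableSet).2 hP
  have hz : P {x | x ∈ cube d ∧ P {x} = 0} = 0 := by
    have hcount : {x | x ∈ cube d ∧ P {x} = 0}.Countable :=
      (cube_countable d).mono fun x hx => hx.1
    rw [← Set.biUnion_of_singleton {x | x ∈ cube d ∧ P {x} = 0}]
    exact (measure_biUnion_null_iff hcount).2 fun x hx => hx.2
  have hz' : ∀ᵐ x ∂P, ¬ (x ∈ cube d ∧ P {x} = 0) := by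
    simpa [ae_iff] using hz
  filter_upwards [hc, hz'] with x hx hx'
  exact h x fun h0 => hx' ⟨hx, h0⟩

theorem abs_sub_le_tvDist {X : Type*} [MeasurableSpace X] (P Q : Measure X)
    [IsProbabilityMeasure P] [IsProbabilityMeasure Q] {s : Set X} (hs : MeasurableSet s) :
    |(P s).toReal - (Q s).toReal| ≤ tvDist P Q := by
  refine le_ciSup (f := fun s : {s : Set X // MeasurableSet s} =>
    |(P s).toReal - (Q s).toReal|) ⟨1, ?_⟩ ⟨s, hs⟩
  rintro _ ⟨t, rfl⟩
  have h1 : (P t).toReal ≤ 1 := measureReal_le_one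
  have h2 : (Q t).toReal ≤ 1 := measureReal_le_one
  have h3 : 0 ≤ (P t).toReal := ENNReal.toReal_nonneg
  have h4 : 0 ≤ (Q t).toReal := ENNReal.toReal_nonneg
  exact abs_le.2 ⟨by linarith, by linarith⟩

theorem nonneg_of_sgn_mul_eq {y s t : ℝ} (hy : y = 1 ∨ y = -1) (hs : 0 < s)
    (h : sgn (y * s) = sgn (y * t)) : 0 ≤ t := by
  unfold sgn at h
  by_contra! ht
  rcases hy with rfl | rfl <;> split_ifs at h <;> linarith

/-- The event that the two block sums have the same sign. -/
def agreeSet (d : ℕ) : Set (Pair d) := {x | sgn (∑ i, x.1 i) = sgn (∑ i, x.2 i)}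

theorem measurableSet_agreeSet (d : ℕ) : MeasurableSet (agreeSet d) :=
  measurableSet_eq_fun (measurable_sgn.comp (by fun_prop)) (measurable_sgn.comp (by fun_prop))

theorem Dzero_agreeSet {d : ℕ} (ν ν' : Measure (Fin d → ℝ)) :
    Dzero ν ν' (agreeSet d) = (unifSign.prod (ν.prod ν'))
      {q | sgn (q.1 * ∑ i, q.2.1 i) = sgn (q.1 * ∑ i, q.2.2 i)} := by
  rw [Dzero, Measure.map_apply (by fun_prop) (measurableSet_agreeSet d)]
  simp [agreeSet, Finset.mul_sum]

theorem Dzero_agreeSet_le_right {d : ℕ} (ν ν' : Measure (Fin d → ℝ))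
    [IsProbabilityMeasure ν] [IsProbabilityMeasure ν'] (h : ∀ᵐ x ∂ν, 0 < ∑ i, x i) :
    Dzero ν ν' (agreeSet d) ≤ ν' {x | 0 ≤ ∑ i, x i} := by
  have hle : Dzero ν ν' (agreeSet d) ≤
      (unifSign.prod (ν.prod ν')) (Set.univ ×ˢ (Set.univ ×ˢ {x | 0 ≤ ∑ i, x i})) := by
    rw [Dzero_agreeSet]
    refine measure_mono_ae ?_
    have hy := Measure.quasiMeasurePreserving_fst (μ := unifSign) (ν := ν.prod ν') |>.ae ae_unifSign
    have hs := Measure.quasiMeasurePreserving_snd (μ := unifSign) (ν := ν.prod ν') |>.ae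
      (Measure.quasiMeasurePreserving_fst (μ := ν) (ν := ν') |>.ae h)
    filter_upwards [hy, hs] with q hq hq' heq
    exact ⟨trivial, trivial, nonneg_of_sgn_mul_eq hq hq' heq⟩
  simpa [Measure.prod_prod] using hle

theorem Dzero_agreeSet_le_left {d : ℕ} (ν ν' : Measure (Fin d → ℝ))
    [IsProbabilityMeasure ν] [IsProbabilityMeasure ν'] (h : ∀ᵐ x ∂ν', 0 < ∑ i, x i) :
    Dzero ν ν' (agreeSet d) ≤ ν {x | 0 ≤ ∑ i, x i} := by
  have hle : Dzero ν ν' (agreeSet d) ≤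
      (unifSign.prod (ν.prod ν')) (Set.univ ×ˢ ({x | 0 ≤ ∑ i, x i} ×ˢ Set.univ)) := by
    rw [Dzero_agreeSet]
    refine measure_mono_ae ?_
    have hy := Measure.quasiMeasurePreserving_fst (μ := unifSign) (ν := ν.prod ν') |>.ae ae_unifSign
    have hs := Measure.quasiMeasurePreserving_snd (μ := unifSign) (ν := ν.prod ν') |>.ae
      (Measure.quasiMeasurePreserving_snd (μ := ν) (ν := ν') |>.ae h)
    filter_upwards [hy, hs] with q hq hq' heq
    exact ⟨trivial, nonneg_of_sgn_mul_eq hq hq' heq.symm, trivial⟩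
  simpa [Measure.prod_prod] using hle

theorem mul_mul_cancel_of_mem_cube {d : ℕ} {a : Fin d → ℝ} (ha : a ∈ cube d) (i : Fin d)
    (t : ℝ) : a i * (a i * t) = t := by
  rcases ha i with h | h <;> simp [h]

theorem Dab_agree {d : ℕ} (P1 Pm1 : Measure (Fin d → ℝ)) {a : Pair d}
    (ha1 : a.1 ∈ cube d) (ha2 : a.2 ∈ cube d) (b : Bool) :
    Dab P1 Pm1 a b {x | fab a false x = fab a true x} = Db P1 Pm1 b (agreeSet d) := by
  have hm : MeasurableSet {x : Pair d | fab a false x = fab a true x} := by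
    simp only [fab, Bool.false_eq_true, if_true, if_false]
    exact measurableSet_eq_fun (measurable_sgn.comp (by fun_prop))
      (measurable_sgn.comp (by fun_prop))
  rw [Dab, Measure.map_apply (by fun_prop) hm]
  simp [agreeSet, fab, mul_mul_cancel_of_mem_cube ha1, mul_mul_cancel_of_mem_cube ha2]

/-- If every `x` in the support of `P₁` satisfies `∑ᵢ xᵢ > 0` and
`d_TV(P₁, -P₋₁) ≤ δ`, then for every `a ∈ {-1,1}^{2d}` and `b ∈ {0,1}`,
`Pr_{x∼D_{a,b}}[f_{a,0}(x) = f_{a,1}(x)] ≤ δ`. -/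
theorem disagreement_of_Dab (d : ℕ) (P1 Pm1 : Measure (Fin d → ℝ))
    [IsProbabilityMeasure P1] [IsProbabilityMeasure Pm1]
    (hP1 : P1 (cube d) = 1) (hPm1 : Pm1 (cube d) = 1)
    (hsupp : ∀ x : Fin d → ℝ, P1 {x} ≠ 0 → 0 < ∑ i, x i)
    (δ : ℝ) (htv : tvDist P1 (Measure.map (fun x i => -x i) Pm1) ≤ δ)
    (a : Pair d) (ha1 : a.1 ∈ cube d) (ha2 : a.2 ∈ cube d) (b : Bool) :
    ((Dab P1 Pm1 a b) {x : Pair d | fab a false x = fab a true x}).toReal ≤ δ := by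
  have hpos := ae_of_forall_atom hP1 hsupp
  have hle : Dab P1 Pm1 a b {x | fab a false x = fab a true x} ≤ Pm1 {x | 0 ≤ ∑ i, x i} := by
    rw [Dab_agree P1 Pm1 ha1 ha2]
    cases b
    · exact Dzero_agreeSet_le_right P1 Pm1 hpos
    · exact Dzero_agreeSet_le_left Pm1 P1 hpos
  have hneg : Measurable fun (x : Fin d → ℝ) i => -x i := by fun_prop
  have hs : MeasurableSet {x : Fin d → ℝ | ∑ i, x i ≤ 0} :=
    measurableSet_le (by fun_prop) measurable_const
  have : IsProbabilityMeasure (Measure.map (fun (x : Fin d → ℝ) i => -x i) Pm1) :=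
    Measure.isProbabilityMeasure_map hneg.aemeasurable
  have h0 : P1 {x | ∑ i, x i ≤ 0} = 0 := by simpa [ae_iff] using hpos
  have htv' := (abs_sub_le_tvDist P1 _ hs).trans htv
  rw [h0, Measure.map_apply hneg hs] at htv'
  simp only [Set.preimage_ofPred_eq, Finset.sum_neg_distrib, Left.neg_nonpos_iff,
    ENNReal.toReal_zero, zero_sub, abs_neg, ENNReal.abs_toReal] at htv'
  exact (ENNReal.toReal_mono (measure_ne_top _ _) hle).trans htv'
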